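/- Let 0 < α < β < ∞. Then limsup_{n→∞} ∫₀¹ n^{1/α} x_n(ω) dω ≤ (1/2)(α p₁)^{-1/α}. -/

import Mathlib

open MeasureTheory Filter Set Topology

noncomputable section

/-- The Liverani–Saussol–Vaienti map `T_a` on `[0,1]`. -/
def lsv (a x : ℝ) : ℝ := if x ≤ 1 / 2 then x * (1 + (2 : ℝ) ^ a * x ^ a) else 2 * x - 1

/-- Random parameter selection: `α` on `[0,p₁)`, `β` on `[p₁,1]`. -/
def alphaOf (α β p₁ ω : ℝ) : ℝ := if ω < p₁ then α else β

/-- The noise dynamics `φ` on `[0,1]`. -/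
def phiMap (p₁ ω : ℝ) : ℝ := if ω < p₁ then ω / p₁ else (ω - p₁) / (1 - p₁)

/-- The skew product `S(x,ω) = (T_{α(ω)} x, φ ω)`. -/
def skewLSV (α β p₁ : ℝ) (p : ℝ × ℝ) : ℝ × ℝ :=
  (lsv (alphaOf α β p₁ p.2) p.1, phiMap p₁ p.2)

/-- The base of inducing, `Δ₀ = (1/2,1] × [0,1]`. -/
def Δ0 : Set (ℝ × ℝ) := Ioc (1 / 2 : ℝ) 1 ×ˢ Icc (0 : ℝ) 1

/-- Tangent-line bound for the convex function `r ↦ r ^ (-a)` at `r = 1`. -/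
lemma one_sub_mul_le_rpow_neg {a r : ℝ} (ha : 0 ≤ a) (hr : 0 < r) :
    1 - a * (r - 1) ≤ r ^ (-a) := by
  rw [Real.rpow_def_of_pos hr]
  have h1 := Real.add_one_le_exp (Real.log r * -a)
  have h2 := mul_le_mul_of_nonneg_left (Real.log_le_sub_one_of_pos hr) ha
  linarith

/-- If `v + v ^ (1 + a) ≤ u`, then `u - v` is at least a multiple of `u ^ (1 + a)`. -/
lemma mul_rpow_le_sub {a c δ u v : ℝ} (ha : 0 < a) (hu : 0 < u) (hδ' : δ < 1)
    (hc : c ≤ (1 - δ) ^ (1 + a)) (hcu : c * u ^ a ≤ δ)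
    (hv : v + v ^ (1 + a) ≤ u) : c * u ^ (1 + a) ≤ u - v := by
  rcases le_total ((1 - δ) * u) v with h | h
  · calc c * u ^ (1 + a) ≤ (1 - δ) ^ (1 + a) * u ^ (1 + a) := by gcongr
      _ = ((1 - δ) * u) ^ (1 + a) := (Real.mul_rpow (by linarith) hu.le).symm
      _ ≤ v ^ (1 + a) := Real.rpow_le_rpow (by nlinarith) h (by linarith)
      _ ≤ u - v := by linarith
  · have h1 := mul_le_mul_of_nonneg_right hcu hu.le
    rw [Real.rpow_add hu, Real.rpow_one]
    linarith

lemma rpow_neg_add_le_rpow_neg {a c p u u' v : ℝ} (ha : 0 < a) (hp : 0 ≤ p)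
    (hu : 0 < u) (hu' : 0 < u') (huv : u' ≤ p * v + (1 - p) * u)
    (h : c * u ^ (1 + a) ≤ u - v) : u ^ (-a) + a * p * c ≤ u' ^ (-a) := by
  have h1 := one_sub_mul_le_rpow_neg ha.le (div_pos hu' hu)
  rw [Real.div_rpow hu'.le hu.le, le_div_iff₀ (by positivity)] at h1
  have h2 : c * u ^ a ≤ (u - v) / u := by
    rw [le_div_iff₀ hu]
    rw [Real.rpow_add hu, Real.rpow_one] at h
    linarith
  have h3 : p * ((u - v) / u) ≤ 1 - u' / u := by
    rw [mul_div_assoc', div_le_iff₀ hu, sub_mul, div_mul_cancel₀ _ hu.ne']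
    linarith
  have h4 : a * (p * (c * u ^ a)) ≤ a * (1 - u' / u) := by
    refine mul_le_mul_of_nonneg_left (le_trans ?_ h3) ha.le
    exact mul_le_mul_of_nonneg_left h2 hp
  have h5 := mul_le_mul_of_nonneg_right h4 (Real.rpow_pos_of_pos hu (-a)).le
  have h6 : u ^ a * u ^ (-a) = 1 := by
    rw [← Real.rpow_add hu]; simp
  have h7 : a * (p * (c * u ^ a)) * u ^ (-a) = a * p * c := by
    linear_combination (a * p * c) * h6
  linarith

/-- A positive sequence whose increments are eventually at least `d` eventually dominates
`k * n` for each `k < d`. -/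
lemma eventually_mul_le_of_add_le {b : ℕ → ℝ} {d k : ℝ} (hb : ∀ᶠ n in atTop, 0 ≤ b n)
    (h : ∀ᶠ n in atTop, b n + d ≤ b (n + 1)) (hk : k < d) :
    ∀ᶠ n : ℕ in atTop, k * n ≤ b n := by
  obtain ⟨N, hN⟩ := eventually_atTop.1 (hb.and h)
  have key : ∀ n ≥ N, d * ((n : ℝ) - N) ≤ b n := by
    intro n hn
    induction n, hn using Nat.le_induction with
    | base => simpa using (hN N le_rfl).1
    | succ n hn ih =>
      have := (hN n hn).2
      push_cast
      linarith
  filter_upwards [eventually_ge_atTop N,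
    tendsto_natCast_atTop_atTop.eventually_ge_atTop (d * N / (d - k))] with n hn hn'
  rw [div_le_iff₀ (by linarith)] at hn'
  have := key n hn
  linarith

/-- Growth of `u n ^ (-a)` along the averaged recursion. -/
lemma eventually_mul_le_rpow_neg {a p k : ℝ} {u v : ℕ → ℝ} (ha : 0 < a) (hp : 0 < p)
    (hu : ∀ n ≥ 1, 0 < u n) (hu1 : ∀ n ≥ 1, u n ≤ 1)
    (hv : ∀ n ≥ 1, v n + v n ^ (1 + a) ≤ u n)
    (huv : ∀ n ≥ 1, u (n + 1) ≤ p * v n + (1 - p) * u n)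
    (hk : 0 < k) (hkap : k < a * p) :
    ∀ᶠ n : ℕ in atTop, k * n ≤ u n ^ (-a) := by
  have hap : 0 < a * p := by positivity
  have hpos : ∀ᶠ n in atTop, 0 ≤ u n ^ (-a) := by
    filter_upwards [eventually_ge_atTop 1] with n hn
    exact (Real.rpow_pos_of_pos (hu n hn) _).le
  have step : ∀ c δ : ℝ, δ < 1 → c ≤ (1 - δ) ^ (1 + a) →
      (∀ᶠ n in atTop, c * u n ^ a ≤ δ) →
      ∀ᶠ n in atTop, u n ^ (-a) + a * p * c ≤ u (n + 1) ^ (-a) := by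
    intro c δ hδ hc h
    filter_upwards [h, eventually_ge_atTop 1] with n hn hn1
    exact rpow_neg_add_le_rpow_neg ha hp.le (hu n hn1) (hu _ (by omega)) (huv n hn1)
      (mul_rpow_le_sub ha (hu n hn1) hδ hc hn (hv n hn1))
  have hlim : Tendsto (fun n => u n ^ (-a)) atTop atTop := by
    have h0 : (0 : ℝ) < (1 / 2) ^ (1 + a) := by positivity
    have h1 : ((1 : ℝ) / 2) ^ (1 + a) ≤ 1 / 2 := by
      have := Real.rpow_le_rpow_of_exponent_ge (by norm_num : (0 : ℝ) < 1 / 2) (by norm_num)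
        (by linarith : (1 : ℝ) ≤ 1 + a)
      simpa using this
    have h2 := step ((1 / 2) ^ (1 + a)) (1 / 2) (by norm_num) (by norm_num) (by
      filter_upwards [eventually_ge_atTop 1] with n hn
      have h3 := Real.rpow_le_one (hu n hn).le (hu1 n hn) ha.le
      nlinarith)
    have hd : 0 < a * p * (1 / 2) ^ (1 + a) := by positivity
    refine tendsto_atTop_mono' _ (eventually_mul_le_of_add_le hpos h2 (half_lt_self hd)) ?_
    exact tendsto_natCast_atTop_atTop.const_mul_atTop (half_pos hd)
  obtain ⟨k', hkk', hk'⟩ := exists_between hkap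
  set c := k' / (a * p) with hc
  have hc0 : 0 < c := div_pos (hk.trans hkk') hap
  have hc1 : c < 1 := (div_lt_one hap).2 hk'
  have hcr : c ^ (1 / (1 + a)) < 1 := Real.rpow_lt_one hc0.le hc1 (by positivity)
  have hstep := step c (1 - c ^ (1 / (1 + a)))
    (by linarith [Real.rpow_pos_of_pos hc0 (1 / (1 + a))])
    (by
      rw [sub_sub_cancel, ← Real.rpow_mul hc0.le, one_div_mul_cancel (by linarith),
        Real.rpow_one])
    (by
      filter_upwards [hlim.eventually_ge_atTop (c / (1 - c ^ (1 / (1 + a)))),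
        eventually_ge_atTop 1] with n hn hn1
      rw [Real.rpow_neg (hu n hn1).le, div_le_iff₀ (by linarith), inv_mul_eq_div,
        le_div_iff₀ (Real.rpow_pos_of_pos (hu n hn1) a)] at hn
      exact hn)
  rw [hc, mul_div_cancel₀ _ hap.ne'] at hstep
  exact eventually_mul_le_of_add_le hpos hstep hkk'

lemma measurable_alphaOf (α β p₁ : ℝ) : Measurable (alphaOf α β p₁) :=
  Measurable.ite measurableSet_Iio measurable_const measurable_const

lemma measurable_phiMap (p₁ : ℝ) : Measurable (phiMap p₁) :=
  Measurable.ite measurableSet_Iio (by fun_prop) (by fun_prop)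

lemma lsv_eq {a x : ℝ} (hx : 0 ≤ x) (hx' : x ≤ 1 / 2) :
    lsv a x = x * (1 + (2 * x) ^ a) := by
  rw [lsv, if_pos hx', Real.mul_rpow (by norm_num) hx]

lemma lsv_strictMonoOn {a : ℝ} (ha : 0 < a) : StrictMonoOn (lsv a) (Icc 0 (1 / 2)) := by
  intro x hx y hy hxy
  rw [lsv_eq hx.1 hx.2, lsv_eq hy.1 hy.2]
  have h1 : (2 * x) ^ a ≤ (2 * y) ^ a :=
    Real.rpow_le_rpow (by linarith [hx.1]) (by linarith) ha.le
  have h2 : 0 ≤ (2 * x) ^ a := Real.rpow_nonneg (by linarith [hx.1]) a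
  have h3 : x * (2 * x) ^ a ≤ y * (2 * y) ^ a := mul_le_mul hxy.le h1 h2 hy.1
  linarith

/-- Measurability passes through the left inverse branch of a random LSV map. -/
lemma measurable_of_lsv_eq {a f g : ℝ → ℝ} (ha : Measurable a) (ha0 : ∀ ω, 0 < a ω)
    (hg : Measurable g) (hf : ∀ ω, f ω ∈ Ioc (0 : ℝ) (1 / 2))
    (h : ∀ ω, lsv (a ω) (f ω) = g ω) : Measurable f := by
  refine measurable_of_Iic fun c => ?_
  rcases lt_or_ge c 0 with hc | hc
  · convert MeasurableSet.empty
    ext ω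
    simpa using hc.trans (hf ω).1
  rcases le_or_gt c (1 / 2) with hc' | hc'
  · have hset : f ⁻¹' Iic c = {ω | g ω ≤ c * (1 + (2 * c) ^ a ω)} := by
      ext ω
      rw [mem_preimage, mem_Iic, mem_ofPred_eq, ← h, ← lsv_eq hc hc']
      exact ((lsv_strictMonoOn (ha0 ω)).le_iff_le ⟨(hf ω).1.le, (hf ω).2⟩ ⟨hc, hc'⟩).symm
    rw [hset]
    exact measurableSet_le hg (by fun_prop)
  · convert MeasurableSet.univ
    ext ω
    simpa using (hf ω).2.trans hc'.le

lemma rpow_integral_le_integral_rpow {f : ℝ → ℝ} {q : ℝ} (hq : 1 ≤ q) (hf : Measurable f)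
    (hf0 : ∀ t, f t ∈ Icc (0 : ℝ) 1) :
    (∫ t in (0 : ℝ)..1, f t) ^ q ≤ ∫ t in (0 : ℝ)..1, f t ^ q := by
  rw [intervalIntegral.integral_of_le zero_le_one, intervalIntegral.integral_of_le zero_le_one]
  have : IsProbabilityMeasure (volume.restrict (Ioc (0 : ℝ) 1)) := ⟨by simp⟩
  refine (convexOn_rpow hq).map_integral_le (Real.continuous_rpow_const (by linarith)).continuousOn
    isClosed_Ici (ae_of_all _ fun t => (hf0 t).1) ?_ ?_
  · exact Integrable.of_mem_Icc 0 1 hf.aemeasurable (ae_of_all _ hf0)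
  · refine Integrable.of_mem_Icc 0 1 (hf.pow_const q).aemeasurable (ae_of_all _ fun t => ?_)
    exact ⟨Real.rpow_nonneg (hf0 t).1 q, Real.rpow_le_one (hf0 t).1 (hf0 t).2 (by linarith)⟩

lemma intervalIntegrable_of_mem_Icc {f : ℝ → ℝ} (hf : Measurable f)
    (hf0 : ∀ t, f t ∈ Icc (0 : ℝ) 1) (s t : ℝ) : IntervalIntegrable f volume s t := by
  constructor <;> exact Integrable.of_mem_Icc 0 1 hf.aemeasurable (ae_of_all _ hf0)

/-- One step of the averaged recursion: `Y` and `Z` stand for twice consecutive random points. -/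
lemma integral_step {α β p : ℝ} {Y Z : ℝ → ℝ} (hα : 0 < α) (hp : 0 < p) (hp' : p < 1)
    (hY : Measurable Y) (hZ : Measurable Z) (hY0 : ∀ ω, Y ω ∈ Icc (0 : ℝ) 1)
    (hZ0 : ∀ ω, Z ω ∈ Icc (0 : ℝ) 1)
    (h : ∀ ω, Z ω + Z ω ^ (1 + alphaOf α β p ω) = Y (phiMap p ω)) :
    (∫ t in (0 : ℝ)..1, Z (p * t)) + (∫ t in (0 : ℝ)..1, Z (p * t)) ^ (1 + α)
        ≤ ∫ t in (0 : ℝ)..1, Y t ∧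
      ∫ t in (0 : ℝ)..1, Z t ≤
        p * (∫ t in (0 : ℝ)..1, Z (p * t)) + (1 - p) * ∫ t in (0 : ℝ)..1, Y t := by
  have hA : Measurable fun t => Z (p * t) := by fun_prop
  have hAr : Measurable fun t => Z (p * t) ^ (1 + α) := by fun_prop
  have hA0 : ∀ t, Z (p * t) ∈ Icc (0 : ℝ) 1 := fun t => hZ0 _
  have hAr0 : ∀ t, Z (p * t) ^ (1 + α) ∈ Icc (0 : ℝ) 1 := fun t =>
    ⟨Real.rpow_nonneg (hA0 t).1 _, Real.rpow_le_one (hA0 t).1 (hA0 t).2 (by linarith)⟩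
  have hB : Measurable fun t => Z (p + (1 - p) * t) := by fun_prop
  constructor
  · have hJ := rpow_integral_le_integral_rpow (by linarith : 1 ≤ 1 + α) hA hA0
    refine (add_le_add_right hJ _).trans ?_
    rw [← intervalIntegral.integral_add (intervalIntegrable_of_mem_Icc hA hA0 _ _)
      (intervalIntegrable_of_mem_Icc hAr hAr0 _ _)]
    refine intervalIntegral.integral_mono_on_of_le_Ioo zero_le_one
      ((intervalIntegrable_of_mem_Icc hA hA0 _ _).add
        (intervalIntegrable_of_mem_Icc hAr hAr0 _ _))
      (intervalIntegrable_of_mem_Icc hY hY0 _ _) fun t ht => ?_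
    have hlt : p * t < p := by nlinarith [ht.2]
    have := h (p * t)
    rw [alphaOf, phiMap, if_pos hlt, if_pos hlt, mul_div_cancel_left₀ _ hp.ne'] at this
    exact this.le
  · have hsplit := intervalIntegral.integral_add_adjacent_intervals
      (intervalIntegrable_of_mem_Icc hZ hZ0 0 p) (intervalIntegrable_of_mem_Icc hZ hZ0 p 1)
    have h1 : p * (∫ t in (0 : ℝ)..1, Z (p * t)) = ∫ t in (0 : ℝ)..p, Z t := by
      simp
    have h2 : (1 - p) * (∫ t in (0 : ℝ)..1, Z (p + (1 - p) * t)) = ∫ t in p..1, Z t := by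
      simp
    rw [← hsplit, ← h1, ← h2]
    refine add_le_add_right (mul_le_mul_of_nonneg_left ?_ (by linarith)) _
    refine intervalIntegral.integral_mono_on zero_le_one
      (intervalIntegrable_of_mem_Icc hB (fun t => hZ0 _) _ _)
      (intervalIntegrable_of_mem_Icc hY hY0 _ _) fun t ht => ?_
    have hge : ¬ p + (1 - p) * t < p := by nlinarith [ht.1]
    have h3 := h (p + (1 - p) * t)
    rw [phiMap, if_neg hge, add_sub_cancel_left, mul_div_cancel_left₀ _ (by linarith)] at h3
    rw [← h3]
    exact le_add_of_nonneg_right (Real.rpow_nonneg (hZ0 _).1 _)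

/-- Lemma 2.5: `limsup_n ∫₀¹ n^{1/α} x_n(ω) dω ≤ (1/2)(α p₁)^{-1/α}`. -/
theorem limsup_expectation (α β p₁ : ℝ) (hα : 0 < α) (hαβ : α < β)
    (hp₁ : 0 < p₁) (hp₁' : p₁ < 1)
    (X : ℕ → ℝ → ℝ) (hX1 : ∀ ω, X 1 ω = 1 / 2)
    (hX : ∀ n, 2 ≤ n → ∀ ω, X n ω ∈ Ioc (0 : ℝ) (1 / 2) ∧
      lsv (alphaOf α β p₁ ω) (X n ω) = X (n - 1) (phiMap p₁ ω)) :
    Filter.limsup (fun n : ℕ => ∫ ω in Icc (0 : ℝ) 1, (n : ℝ) ^ (1 / α) * X n ω) atTop ≤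
      (1 / 2 : ℝ) * (α * p₁) ^ (-(1 / α)) := by
  have hmem : ∀ n ≥ 1, ∀ ω, X n ω ∈ Ioc (0 : ℝ) (1 / 2) := by
    intro n hn ω
    rcases hn.eq_or_lt with rfl | hn
    · rw [hX1]; norm_num
    · exact (hX n hn ω).1
  have ha0 : ∀ ω, 0 < alphaOf α β p₁ ω := by
    intro ω
    unfold alphaOf
    split_ifs <;> linarith
  have hmeas : ∀ n ≥ 1, Measurable (X n) := by
    intro n hn
    induction n, hn using Nat.le_induction with
    | base => simpa only [funext hX1] using measurable_const
    | succ n hn ih =>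
      exact measurable_of_lsv_eq (measurable_alphaOf α β p₁) ha0
        (ih.comp (measurable_phiMap p₁)) (hmem _ (by omega))
        fun ω => (hX (n + 1) (by omega) ω).2
  have hYmeas : ∀ n ≥ 1, Measurable fun ω => 2 * X n ω := fun n hn => (hmeas n hn).const_mul 2
  have hYmem : ∀ n ≥ 1, ∀ ω, 2 * X n ω ∈ Icc (0 : ℝ) 1 := fun n hn ω =>
    ⟨by linarith [(hmem n hn ω).1], by linarith [(hmem n hn ω).2]⟩
  set u : ℕ → ℝ := fun n => ∫ t in (0 : ℝ)..1, 2 * X n t with hu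
  have hupos : ∀ n ≥ 1, 0 < u n := fun n hn =>
    intervalIntegral.intervalIntegral_pos_of_pos_on
      (intervalIntegrable_of_mem_Icc (hYmeas n hn) (hYmem n hn) _ _)
      (fun t _ => by linarith [(hmem n hn t).1]) zero_lt_one
  have hule : ∀ n ≥ 1, u n ≤ 1 := by
    intro n hn
    have := intervalIntegral.integral_mono_on zero_le_one
      (intervalIntegrable_of_mem_Icc (hYmeas n hn) (hYmem n hn) 0 1)
      intervalIntegrable_const (fun t _ => (hYmem n hn t).2)
    simpa [hu] using this
  have hstep := fun n (hn : n ≥ 1) =>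
    integral_step (α := α) (β := β) hα hp₁ hp₁' (hYmeas n hn) (hYmeas (n + 1) (by omega))
      (hYmem n hn) (hYmem (n + 1) (by omega)) (fun ω => by
        obtain ⟨h1, h2⟩ := hX (n + 1) (by omega) ω
        rw [lsv_eq h1.1.le h1.2, Nat.add_sub_cancel] at h2
        rw [Real.rpow_add (by linarith [h1.1]), Real.rpow_one, ← h2]
        ring)
  have hint : ∀ n : ℕ, ∫ ω in Icc (0 : ℝ) 1, (n : ℝ) ^ (1 / α) * X n ω
      = 1 / 2 * ((n : ℝ) ^ (1 / α) * u n) := by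
    intro n
    rw [integral_Icc_eq_integral_Ioc, ← intervalIntegral.integral_of_le zero_le_one, hu]
    simp only [intervalIntegral.integral_const_mul]
    ring
  simp only [hint]
  have hbound : ∀ k, 0 < k → k < α * p₁ →
      limsup (fun n : ℕ => 1 / 2 * ((n : ℝ) ^ (1 / α) * u n)) atTop
        ≤ 1 / 2 * k ^ (-(1 / α)) := by
    intro k hk hk'
    refine limsup_le_of_le ?_ ?_
    · refine IsBoundedUnder.isCoboundedUnder_le ⟨0, ?_⟩
      rw [eventually_map]
      filter_upwards [eventually_ge_atTop 1] with n hn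
      have := hupos n hn
      positivity
    · filter_upwards [eventually_mul_le_rpow_neg hα hp₁ hupos hule
        (fun n hn => (hstep n hn).1) (fun n hn => (hstep n hn).2) hk hk',
        eventually_ge_atTop 1] with n hn hn1
      have hun := hupos n hn1
      have hn0 : (0 : ℝ) < n := by exact_mod_cast hn1
      have h1 := Real.rpow_le_rpow (by positivity) hn (by positivity : 0 ≤ 1 / α)
      rw [Real.mul_rpow hk.le hn0.le, ← Real.rpow_mul hun.le, neg_mul,
        mul_one_div_cancel hα.ne', Real.rpow_neg_one] at h1
      refine mul_le_mul_of_nonneg_left ?_ (by norm_num)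
      rw [Real.rpow_neg hk.le, ← one_div, le_div_iff₀ (by positivity)]
      calc (n : ℝ) ^ (1 / α) * u n * k ^ (1 / α)
          = k ^ (1 / α) * (n : ℝ) ^ (1 / α) * u n := by ring
        _ ≤ (u n)⁻¹ * u n := by gcongr
        _ = 1 := inv_mul_cancel₀ hun.ne'
  have hap : 0 < α * p₁ := by positivity
  have hcont : Tendsto (fun k : ℝ => 1 / 2 * k ^ (-(1 / α))) (𝓝[<] (α * p₁))
      (𝓝 (1 / 2 * (α * p₁) ^ (-(1 / α)))) :=
    ((Real.continuousAt_rpow_const _ _ (Or.inl hap.ne')).tendsto.const_mul _).mono_left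
      nhdsWithin_le_nhds
  refine ge_of_tendsto hcont ?_
  filter_upwards [Ioo_mem_nhdsLT hap] with k hk
  exact hbound k hk.1 hk.2
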